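/- arXiv:1207.0586 — 3 statements merged into one kernel-verified Lean document; each statement's English description precedes it below -/
import Mathlib

section
/- Let a, b ∈ ℝ with 0 ≤ a < b. Then the improper integral ∫₀^∞ cos(at) J₀(bt) dt converges and equals 1/√(b² − a²); that is, lim_{T→∞} ∫₀^T cos(at) J₀(bt) dt = 1/√(b² − a²). -/
open Real Filter Topology

/-- Bessel function of the first kind of order zero. -/
noncomputable def J0 (x : ℝ) : ℝ := (1 / π) * ∫ t in (0:ℝ)..π, Real.cos (x * Real.sin t)


lemma RL (f : ℝ → ℝ) (hf : MeasureTheory.Integrable f) (c : ℝ → ℝ) :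
    Tendsto (fun T : ℝ => ∫ u, Real.sin (T * u + c T) * f u) atTop (𝓝 0) := by
  have h := Real.tendsto_integral_exp_smul_cocompact (fun u => (f u : ℂ))
  have hw : Tendsto (fun T : ℝ => -T / (2 * π)) atTop (cocompact ℝ) := by
    refine Tendsto.mono_right ?_ atBot_le_cocompact
    exact (tendsto_neg_atTop_atBot).atBot_div_const (by positivity)
  have h2 := (h.comp hw).norm
  rw [norm_zero] at h2
  refine squeeze_zero_norm (fun T => ?_) h2
  have e : ∀ u : ℝ, Real.sin (T * u + c T) * f u =
      (Complex.exp (c T * Complex.I) * ((fourierChar (-(u * (-T / (2 * π)))) : ℂ) * (f u : ℂ))).im := by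
    intro u
    rw [Real.fourierChar_apply, ← mul_assoc, ← Complex.exp_add, Complex.im_mul_ofReal]
    congr 1
    have : (c T * Complex.I + ((2 * π * -(u * (-T / (2 * π))) : ℝ) : ℂ) * Complex.I)
        = ((T * u + c T : ℝ) : ℂ) * Complex.I := by
      have h1 : (2 * π * -(u * (-T / (2 * π))) : ℝ) = T * u := by field_simp
      rw [h1]; push_cast; ring
    rw [this, Complex.exp_ofReal_mul_I_im]
  have hi : MeasureTheory.Integrable (fun u : ℝ => Complex.exp (c T * Complex.I) * ((fourierChar (-(u * (-T / (2 * π)))) : ℂ) * (f u : ℂ))) := by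
    refine MeasureTheory.Integrable.const_mul ?_ _
    refine hf.ofReal.bdd_mul (c := 1) ?_ ?_
    · exact Continuous.aestronglyMeasurable (by fun_prop)
    · filter_upwards with u
      exact (Circle.norm_coe _).le
  simp_rw [e]
  have h3 := integral_im hi
  simp only [RCLike.im_to_complex] at h3
  rw [h3, MeasureTheory.integral_const_mul]
  refine (Complex.abs_im_le_norm _).trans ?_
  rw [norm_mul, Complex.norm_exp_ofReal_mul_I, one_mul]
  exact le_of_eq rfl

lemma sinc_bound (x : ℝ) (h1 : -(π/2) < x) (h2 : x < π/2) : |(sinc x - 1) / sin x| ≤ 1 := by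
  wlog hx : 0 ≤ x generalizing x with H
  · have := H (-x) (by linarith) (by linarith) (by linarith)
    rwa [sinc_neg, sin_neg, div_neg, abs_neg] at this
  rcases hx.eq_or_lt with rfl | hx
  · simp
  have hs : 0 < sin x := sin_pos_of_pos_of_lt_pi hx (by linarith [pi_pos])
  have hc : 0 < cos x := cos_pos_of_mem_Ioo ⟨h1, h2⟩
  have ht := Real.le_tan hx.le h2
  rw [tan_eq_sin_div_cos, le_div_iff₀ hc] at ht
  have h3 : cos x ≤ sinc x := by
    rw [sinc_of_ne_zero hx.ne', le_div_iff₀ hx]; linarith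
  rw [abs_div, abs_of_pos hs, div_le_one hs, abs_le]
  constructor
  · nlinarith [sin_sq_add_cos_sq x, sin_le_one x, cos_le_one x]
  · linarith [sinc_le_one x]


noncomputable def Dk (n : ℕ) (x : ℝ) : ℝ := 1 + 2 * ∑ k ∈ Finset.range n, cos ((2 * (k + 1) : ℝ) * x)

lemma Dk_sin (n : ℕ) (x : ℝ) : Dk n x * sin x = sin ((2 * n + 1) * x) := by
  induction n with
  | zero => simp [Dk]
  | succ n ih =>
    have : Dk (n+1) x = Dk n x + 2 * cos ((2 * (n + 1) : ℝ) * x) := by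
      simp only [Dk, Finset.sum_range_succ]; ring
    rw [this, add_mul, ih]
    have e1 : ((2 * n + 1) * x : ℝ) = (2 * (n + 1)) * x - x := by ring
    have e2 : ((2 * ((n+1 : ℕ):ℝ) + 1) * x : ℝ) = (2 * (n + 1)) * x + x := by push_cast; ring
    rw [e1, e2, sin_sub, sin_add]; ring

lemma Dk_int (n : ℕ) : ∫ x in (-(π/2))..(π/2), Dk n x = π := by
  unfold Dk
  rw [intervalIntegral.integral_add (by simp) (Continuous.intervalIntegrable (by fun_prop) _ _),
    intervalIntegral.integral_const_mul, intervalIntegral.integral_finsetSum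
      (fun i _ => Continuous.intervalIntegrable (by fun_prop) _ _)]
  rw [Finset.sum_eq_zero]
  · simp
  intro k _
  rw [intervalIntegral.integral_comp_mul_left (fun x => cos x) (by positivity)]
  rw [integral_cos]
  have e : (2 * (k + 1) : ℝ) * (π/2) = ((k+1 : ℕ):ℝ) * π := by push_cast; ring
  rw [mul_neg, sin_neg, e, sin_nat_mul_pi]; simp

lemma sinc_nat (n : ℕ) (x : ℝ) (hx : x ≠ 0) (hs : sin x ≠ 0) : (2 * n + 1) * sinc ((2 * n + 1) * x) =
    Dk n x + sin ((2 * n + 1) * x) * ((sinc x - 1) / sin x) := by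
  have hn : (2 * n + 1 : ℝ) ≠ 0 := by positivity
  rw [sinc_of_ne_zero (mul_ne_zero hn hx), sinc_of_ne_zero hx, ← Dk_sin]
  field_simp
  ring

lemma int_nat : Tendsto (fun n : ℕ => ∫ x in (-((2*n+1) * (π/2)))..((2*n+1) * (π/2)), sinc x) atTop (𝓝 π) := by
  set f : ℝ → ℝ := (Set.Ioo (-(π/2)) (π/2)).indicator (fun x => (sinc x - 1) / sin x) with hf
  have hfi : MeasureTheory.Integrable f := by
    rw [hf, MeasureTheory.integrable_indicator_iff measurableSet_Ioo]
    refine MeasureTheory.IntegrableOn.of_bound (by simp) ?_ 1 ?_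
    · exact Measurable.aestronglyMeasurable (by fun_prop)
    · filter_upwards [MeasureTheory.ae_restrict_mem measurableSet_Ioo] with x hx
      exact sinc_bound x hx.1 hx.2
  have h := RL f hfi (fun _ => 0)
  have hn : Tendsto (fun n : ℕ => (2 * n + 1 : ℝ)) atTop atTop :=
    tendsto_atTop_add_const_right _ _ (tendsto_natCast_atTop_atTop.const_mul_atTop (by norm_num))
  have h2 := (h.comp hn).const_add π
  rw [add_zero] at h2
  refine h2.congr (fun n => ?_)
  have hle : -(π/2) ≤ π/2 := by linarith [pi_pos]
  have e1 : ∫ u, sin ((2 * n + 1) * u + 0) * f u =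
      ∫ x in (-(π/2))..(π/2), sin ((2 * n + 1) * x) * ((sinc x - 1) / sin x) := by
    rw [intervalIntegral.integral_of_le hle, MeasureTheory.integral_Ioc_eq_integral_Ioo,
      ← MeasureTheory.integral_indicator measurableSet_Ioo]
    congr 1 with u
    by_cases hu : u ∈ Set.Ioo (-(π/2)) (π/2) <;> simp [hf, hu]
  have hi : IntervalIntegrable (fun x => sin ((2 * n + 1) * x) * ((sinc x - 1) / sin x)) MeasureTheory.volume (-(π/2)) (π/2) := by
    rw [intervalIntegrable_iff_integrableOn_Ioo_of_le hle]
    refine MeasureTheory.Integrable.bdd_mul (c := 1) ((MeasureTheory.integrable_indicator_iff measurableSet_Ioo).1 hfi) ?_ ?_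
    · exact Continuous.aestronglyMeasurable (by fun_prop)
    · filter_upwards with x
      exact abs_sin_le_one _
  have hD : IntervalIntegrable (Dk n) MeasureTheory.volume (-(π/2)) (π/2) :=
    Continuous.intervalIntegrable (by unfold Dk; fun_prop) _ _
  simp only [Function.comp]
  rw [e1]
  refine (congrArg (· + _) (Dk_int n).symm).trans ?_
  rw [← intervalIntegral.integral_add hD hi]
  have e2 := intervalIntegral.smul_integral_comp_mul_left sinc (a := -(π/2)) (b := π/2) (2 * n + 1 : ℝ)
  rw [mul_neg] at e2
  rw [← e2, smul_eq_mul, ← intervalIntegral.integral_const_mul]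
  apply intervalIntegral.integral_congr_ae
  have : ∀ᵐ x : ℝ, x ≠ 0 ∧ x ≠ π/2 := by
    filter_upwards [MeasureTheory.Measure.ae_ne MeasureTheory.volume (0:ℝ), MeasureTheory.Measure.ae_ne MeasureTheory.volume (π/2:ℝ)] with x h1 h2
    exact ⟨h1, h2⟩
  filter_upwards [this] with x hx hxm
  rw [Set.uIoc_of_le hle] at hxm
  refine (sinc_nat n x hx.1 ?_).symm
  intro h0
  exact hx.1 ((sin_eq_zero_iff_of_lt_of_lt (by linarith [hxm.1, pi_pos]) (by linarith [hxm.2, pi_pos])).1 h0)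

lemma half (R : ℝ) : ∫ x in (-R)..R, sinc x = 2 * ∫ x in (0:ℝ)..R, sinc x := by
  have h1 : ∫ x in (-R)..0, sinc x = ∫ x in (0:ℝ)..R, sinc x := by
    have := intervalIntegral.integral_comp_neg (a := 0) (b := R) sinc
    simp only [sinc_neg, neg_zero] at this
    exact this.symm
  rw [← intervalIntegral.integral_add_adjacent_intervals (b := 0)
    (continuous_sinc.intervalIntegrable _ _) (continuous_sinc.intervalIntegrable _ _), h1]; ring

lemma dirichlet : Tendsto (fun R : ℝ => ∫ x in (0:ℝ)..R, sinc x) atTop (𝓝 (π/2)) := by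
  have h1 : Tendsto (fun n : ℕ => ∫ x in (0:ℝ)..((2*n+1) * (π/2)), sinc x) atTop (𝓝 (π/2)) := by
    refine (int_nat.div_const 2).congr (fun n => ?_)
    rw [half]; ring
  have hfl : Tendsto (fun R : ℝ => ⌊R/π⌋₊) atTop atTop :=
    tendsto_nat_floor_atTop.comp (tendsto_id.atTop_div_const pi_pos)
  have h2 := h1.comp hfl
  have h3 : Tendsto (fun R : ℝ => ∫ x in ((2*(⌊R/π⌋₊:ℝ)+1) * (π/2))..R, sinc x) atTop (𝓝 0) := by
    have h4 : Tendsto (fun R : ℝ => 1/((⌊R/π⌋₊:ℝ) * π) * π) atTop (𝓝 0) := by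
      have : Tendsto (fun R : ℝ => (⌊R/π⌋₊:ℝ) * π) atTop atTop :=
        (tendsto_natCast_atTop_atTop.comp hfl).atTop_mul_const pi_pos
      simpa using (this.inv_tendsto_atTop).mul_const π
    refine squeeze_zero_norm' ?_ h4
    filter_upwards [hfl.eventually_ge_atTop 1, eventually_ge_atTop 0] with R hR hR0
    have hn : (1:ℝ) ≤ (⌊R/π⌋₊:ℝ) := by exact_mod_cast hR
    have hl := Nat.floor_le (div_nonneg hR0 pi_pos.le)
    have hu := Nat.lt_floor_add_one (R/π)
    rw [le_div_iff₀ pi_pos] at hl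
    rw [div_lt_iff₀ pi_pos] at hu
    set n : ℝ := (⌊R/π⌋₊:ℝ)
    have hnp : 0 < n * π := by positivity
    refine (intervalIntegral.norm_integral_le_of_norm_le_const (C := 1/(n*π)) ?_).trans ?_
    · intro x hx
      have hx1 : n * π ≤ x := by
        have : min ((2*n+1) * (π/2)) R < x := hx.1
        have h5 : n * π ≤ min ((2*n+1) * (π/2)) R := le_min (by linarith [pi_pos]) hl
        linarith
      have hx0 : 0 < x := by linarith
      rw [sinc_of_ne_zero hx0.ne', Real.norm_eq_abs, abs_div, abs_of_pos hx0]
      exact div_le_div₀ zero_le_one (abs_sin_le_one x) hnp hx1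
    · gcongr
      rw [abs_le]; constructor <;> linarith [pi_pos]
  have h5 := h2.add h3
  rw [add_zero] at h5
  refine h5.congr (fun R => ?_)
  exact intervalIntegral.integral_add_adjacent_intervals
    (continuous_sinc.intervalIntegrable _ _) (continuous_sinc.intervalIntegrable _ _)

lemma RL_sin (k : ℝ → ℝ) (hk : MeasureTheory.IntegrableOn k (Set.Ioo (-(π/2)) (π/2))) (c : ℝ → ℝ) :
    Tendsto (fun T : ℝ => ∫ x in (-(π/2))..(π/2), sin (T * sin x + c T) * k x) atTop (𝓝 0) := by
  have hle : -(π/2) ≤ π/2 := by linarith [pi_pos]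
  set s := Set.Ioo (-(π/2)) (π/2) with hs
  have hinj : Set.InjOn sin s := injOn_sin.mono Set.Ioo_subset_Icc_self
  have hd : ∀ x ∈ s, HasDerivWithinAt sin (cos x) s x := fun x _ => (hasDerivAt_sin x).hasDerivWithinAt
  have hms : MeasurableSet (sin '' s) :=
    measurableSet_Ioo.image_of_continuousOn_injOn continuous_sin.continuousOn hinj
  set g : ℝ → ℝ := fun u => k (arcsin u) / cos (arcsin u) with hg
  have hgs : ∀ x ∈ s, |cos x| * g (sin x) = k x := by
    intro x hx
    have hc : 0 < cos x := cos_pos_of_mem_Ioo hx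
    simp only [hg]
    rw [arcsin_sin hx.1.le hx.2.le, abs_of_pos hc]; field_simp
  have hgi : MeasureTheory.IntegrableOn g (sin '' s) := by
    rw [MeasureTheory.integrableOn_image_iff_integrableOn_abs_deriv_smul measurableSet_Ioo hd hinj]
    exact hk.congr_fun (fun x hx => (hgs x hx).symm) measurableSet_Ioo
  refine (RL ((sin '' s).indicator g) ((MeasureTheory.integrable_indicator_iff hms).2 hgi) c).congr (fun T => ?_)
  have e : ∀ u, sin (T * u + c T) * (sin '' s).indicator g u =
      (sin '' s).indicator (fun u => sin (T * u + c T) * g u) u := by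
    intro u
    by_cases hu : u ∈ sin '' s
    · rw [Set.indicator_of_mem hu, Set.indicator_of_mem hu]
    · rw [Set.indicator_of_notMem hu, Set.indicator_of_notMem hu, mul_zero]
  simp_rw [e]
  rw [MeasureTheory.integral_indicator hms,
    MeasureTheory.integral_image_eq_integral_abs_deriv_smul measurableSet_Ioo hd hinj,
    intervalIntegral.integral_of_le hle, MeasureTheory.integral_Ioc_eq_integral_Ioo]
  refine MeasureTheory.setIntegral_congr_fun measurableSet_Ioo (fun x hx => ?_)
  simp only [smul_eq_mul]
  rw [← hgs x hx]; ring

lemma J0_sym (x : ℝ) : J0 x = (1/π) * ∫ t in (-(π/2))..(π/2), cos (x * sin t) := by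
  unfold J0
  congr 1
  have hi : ∀ p q : ℝ, IntervalIntegrable (fun t => cos (x * sin t)) MeasureTheory.volume p q :=
    fun p q => Continuous.intervalIntegrable (by fun_prop) _ _
  rw [← intervalIntegral.integral_add_adjacent_intervals (hi 0 (π/2)) (hi (π/2) π),
    ← intervalIntegral.integral_add_adjacent_intervals (hi (-(π/2)) 0) (hi 0 (π/2)), add_comm]
  congr 1
  have h1 := intervalIntegral.integral_comp_sub_right (a := π/2) (b := π) (fun t => cos (x * sin t)) π
  have h2 : ∀ t, cos (x * sin (t - π)) = cos (x * sin t) := by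
    intro t; rw [sin_sub_pi, mul_neg, cos_neg]
  simp_rw [h2] at h1
  rw [h1]; congr 1 <;> ring

lemma cos_J0 (a b t : ℝ) : cos (a * t) * J0 (b * t) =
    (1/π) * ∫ x in (-(π/2))..(π/2), cos ((b * sin x - a) * t) := by
  rw [J0_sym, mul_left_comm]
  congr 1
  have h1 : ∫ x in (-(π/2))..(π/2), sin (b * t * sin x) = 0 := by
    have := intervalIntegral.integral_comp_neg (a := -(π/2)) (b := π/2) (fun x => sin (b * t * sin x))
    simp only [sin_neg, mul_neg, neg_neg, intervalIntegral.integral_neg] at this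
    linarith
  have h2 : ∀ x, cos ((b * sin x - a) * t) =
      cos (a * t) * cos (b * t * sin x) + sin (a * t) * sin (b * t * sin x) := by
    intro x
    rw [show (b * sin x - a) * t = b * t * sin x - a * t by ring, cos_sub]; ring
  simp_rw [h2]
  rw [intervalIntegral.integral_add (Continuous.intervalIntegrable (by fun_prop) _ _)
    (Continuous.intervalIntegrable (by fun_prop) _ _), intervalIntegral.integral_const_mul,
    intervalIntegral.integral_const_mul, h1]; ring

lemma int_cos_sinc (p T : ℝ) (hT : 0 < T) : ∫ t in (0:ℝ)..T, cos (p * t) = T * sinc (T * p) := by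
  rcases eq_or_ne p 0 with rfl | hp
  · simp
  · rw [intervalIntegral.integral_comp_mul_left (fun x => cos x) hp, integral_cos,
      sinc_of_ne_zero (mul_ne_zero hT.ne' hp)]
    simp only [mul_zero, sin_zero, sub_zero, smul_eq_mul, mul_comm p T]
    field_simp

lemma swap_int (a b T : ℝ) (hT : 0 < T) : ∫ t in (0:ℝ)..T, cos (a * t) * J0 (b * t) =
    (1/π) * ∫ x in (-(π/2))..(π/2), T * sinc (T * (b * sin x - a)) := by
  simp_rw [cos_J0]
  rw [intervalIntegral.integral_const_mul]
  congr 1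
  rw [MeasureTheory.intervalIntegral_intervalIntegral_swap]
  · simp_rw [int_cos_sinc _ T hT]
  · have hc : Continuous (Function.uncurry fun t x : ℝ => cos ((b * sin x - a) * t)) := by
      unfold Function.uncurry; fun_prop
    refine (hc.continuousOn.integrableOn_compact
      (isCompact_uIcc.prod isCompact_uIcc)).mono_set
      (Set.prod_mono Set.uIoc_subset_uIcc Set.uIoc_subset_uIcc)

theorem stmt_9 (a b : ℝ) (ha : 0 ≤ a) (hab : a < b) :
    Tendsto (fun T : ℝ => ∫ t in (0:ℝ)..T, Real.cos (a * t) * J0 (b * t))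
      atTop (𝓝 (1 / Real.sqrt (b ^ 2 - a ^ 2))) := by
  have hb : 0 < b := by linarith
  have hle : -(π/2) ≤ π/2 := by linarith [pi_pos]
  set p := arcsin (a / b) with hp
  have hab1 : a / b < 1 := (div_lt_one hb).2 hab
  have hab0 : 0 ≤ a / b := by positivity
  have hsp : b * sin p = a := by
    rw [hp, sin_arcsin (by linarith) hab1.le]; field_simp
  have hp0 : 0 ≤ p := arcsin_nonneg.2 hab0
  have hp1 : p < π/2 := arcsin_lt_pi_div_two.2 hab1
  set c := b * cos p with hcdef
  have hcp : 0 < cos p := cos_pos_of_mem_Ioo ⟨by linarith [pi_pos], hp1⟩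
  have hc : 0 < c := by positivity
  have hcs : sqrt (b^2 - a^2) = c := by
    rw [← hsp]
    refine Eq.trans ?_ (sqrt_sq hc.le)
    congr 1
    rw [hcdef]
    nlinarith [sin_sq_add_cos_sq p]
  rw [hcs]
  set k : ℝ → ℝ := fun x => sin ((x + p)/2) / cos ((x + p)/2) with hk
  have hcpos : ∀ x ∈ Set.Icc (-(π/2)) (π/2), 0 < cos ((x+p)/2) := fun x hx =>
    cos_pos_of_mem_Ioo ⟨by linarith [hx.1, pi_pos], by linarith [hx.2]⟩
  have hkc : ContinuousOn k (Set.Icc (-(π/2)) (π/2)) := by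
    refine ContinuousOn.div (by fun_prop) (by fun_prop) (fun x hx => (hcpos x hx).ne')
  -- remainder
  have hR := RL_sin k ((hkc.integrableOn_compact isCompact_Icc).mono_set Set.Ioo_subset_Icc_self)
    (fun S => -(S / b * a))
  have hTb : Tendsto (fun T : ℝ => T * b) atTop atTop := tendsto_id.atTop_mul_const hb
  have hR2 := hR.comp hTb
  -- main term
  have hM1 := dirichlet.comp (tendsto_id.atTop_mul_const (sub_pos.2 hab))
  have hM2 := dirichlet.comp (tendsto_id.atTop_mul_const (by linarith : 0 < b + a))
  have hfin := (((hM1.add hM2).add hR2).const_mul (1/π * (1/c)))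
  have hval : 1/π * (1/c) * (π/2 + π/2 + 0) = 1/c := by
    field_simp; ring
  rw [hval] at hfin
  refine hfin.congr' ?_
  filter_upwards [eventually_gt_atTop 0] with T hT
  rw [swap_int a b T hT, mul_assoc]
  congr 1
  simp only [Function.comp, id]
  have hmain : ∫ x in (-(π/2))..(π/2), T * sinc (T * (b * sin x - a)) * (b * cos x) =
      (∫ x in (0:ℝ)..(T * (b - a)), sinc x) + ∫ x in (0:ℝ)..(T * (b + a)), sinc x := by
    have h1 := intervalIntegral.integral_comp_mul_deriv (a := -(π/2)) (b := π/2)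
      (f := fun x => T * (b * sin x - a)) (f' := fun x => T * (b * cos x)) (g := sinc)
      (fun x _ => (((hasDerivAt_sin x).const_mul b).sub_const a).const_mul T)
      (by fun_prop) continuous_sinc
    have h2 : ∫ x in (0:ℝ)..(T * (b + a)), sinc x = ∫ x in (-(T * (b + a)))..0, sinc x := by
      have := intervalIntegral.integral_comp_neg (a := 0) (b := T * (b + a)) sinc
      simp only [sinc_neg, neg_zero] at this
      exact this
    rw [h2, add_comm, intervalIntegral.integral_add_adjacent_intervals
      (continuous_sinc.intervalIntegrable _ _) (continuous_sinc.intervalIntegrable _ _)]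
    simp only [Function.comp, sin_neg, sin_pi_div_two] at h1
    rw [show -(T * (b + a)) = T * (b * -1 - a) by ring, show T * (b - a) = T * (b * 1 - a) by ring,
      ← h1]
    congr 1 with x
    ring
  rw [← hmain]
  have hI2 : IntervalIntegrable (fun x => sin (T * b * sin x + -(T * b / b * a)) * k x)
      MeasureTheory.volume (-(π/2)) (π/2) := by
    apply ContinuousOn.intervalIntegrable
    rw [Set.uIcc_of_le hle]
    exact ContinuousOn.mul (by fun_prop) hkc
  have hcsinc : Continuous (fun x : ℝ => sinc (T * (b * sin x - a))) :=
    continuous_sinc.comp (by fun_prop)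
  rw [← intervalIntegral.integral_add (Continuous.intervalIntegrable (by fun_prop) _ _) hI2,
    ← intervalIntegral.integral_const_mul]
  apply intervalIntegral.integral_congr
  intro x hx
  rw [Set.uIcc_of_le hle] at hx
  have hcx := hcpos x hx
  have hsm : ∀ y : ℝ, y * sinc y = sin y := by
    intro y
    rcases eq_or_ne y 0 with rfl | hy
    · simp
    · rw [sinc_of_ne_zero hy]; field_simp
  have harg : T * b * sin x + -(T * b / b * a) = T * (b * sin x - a) := by
    field_simp; ring
  have hkey : c - b * cos x = (b * sin x - a) * k x := by
    rw [← hsp, hcdef, ← mul_sub, ← mul_sub, mul_assoc, cos_sub_cos, sin_sub_sin, hk,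
      show (p - x)/2 = -((x - p)/2) by ring, sin_neg, add_comm p x]
    field_simp
  simp only
  rw [harg, ← hsm (T * (b * sin x - a)), show T * (b * sin x - a) * sinc (T * (b * sin x - a)) * k x =
    T * sinc (T * (b * sin x - a)) * ((b * sin x - a) * k x) by ring, ← hkey]
  field_simp
  ring
end

section
/- Let a, b ∈ ℝ with 0 ≤ a < b. Then the improper integral ∫₀^∞ sin(at) Y₀(bt) dt converges and equals (2/π) · arcsin(a/b) / √(b² − a²); that is, lim_{T→∞} ∫₀^T sin(at) Y₀(bt) dt = (2/π) arcsin(a/b) / √(b² − a²). -/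
open Real Filter Topology

lemma osc_gen (φ φ' h h' : ℝ → ℝ) (d S : ℝ) (hdS : d ≤ S)
    (hφ : ∀ s, HasDerivAt φ (φ' s) s) (hφc : Continuous φ')
    (hh : ∀ s ∈ Set.Icc d S, HasDerivAt h (h' s) s) (hhc : ContinuousOn h' (Set.Icc d S))
    (hneg : ∀ s ∈ Set.Icc d S, h' s ≤ 0) (hpos : ∀ s ∈ Set.Icc d S, 0 ≤ h s) :
    |∫ s in d..S, h s * (Real.cos (φ s) * φ' s)| ≤ 2 * h d := by
  have hu : Set.uIcc d S = Set.Icc d S := Set.uIcc_of_le hdS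
  have hφcont : Continuous φ := continuous_iff_continuousAt.2 fun s => (hφ s).continuousAt
  have hi' : IntervalIntegrable h' MeasureTheory.volume d S :=
    ContinuousOn.intervalIntegrable (by rwa [hu])
  have e := intervalIntegral.integral_mul_deriv_eq_deriv_mul (a := d) (b := S)
    (u := h) (u' := h') (v := fun s => Real.sin (φ s)) (v' := fun s => Real.cos (φ s) * φ' s)
    (by rwa [hu]) (fun s _ => (hφ s).sin) hi'
    ((Continuous.mul (by fun_prop) hφc).intervalIntegrable _ _)
  have e2 := intervalIntegral.integral_eq_sub_of_hasDerivAt (a := d) (b := S) (f := h) (f' := h')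
    (by rwa [hu]) hi'
  have e3 : |∫ s in d..S, h' s * Real.sin (φ s)| ≤ h d - h S := by
    have := intervalIntegral.norm_integral_le_of_norm_le (μ := MeasureTheory.volume) hdS
      (f := fun s => h' s * Real.sin (φ s)) (g := fun s => - h' s)
      (Eventually.of_forall fun s hs => by
        have hs' : s ∈ Set.Icc d S := ⟨hs.1.le, hs.2⟩
        rw [Real.norm_eq_abs, abs_mul, abs_of_nonpos (hneg s hs')]
        exact mul_le_of_le_one_right (by linarith [hneg s hs']) (Real.abs_sin_le_one _)) hi'.neg
    rw [intervalIntegral.integral_neg, e2] at this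
    simpa using this
  have h1 := hpos d ⟨le_rfl, hdS⟩
  have h2 := hpos S ⟨hdS, le_rfl⟩
  have b1 : |h S * Real.sin (φ S)| ≤ h S := by
    rw [abs_mul, abs_of_nonneg h2]; exact mul_le_of_le_one_right h2 (Real.abs_sin_le_one _)
  have b2 : |h d * Real.sin (φ d)| ≤ h d := by
    rw [abs_mul, abs_of_nonneg h1]; exact mul_le_of_le_one_right h1 (Real.abs_sin_le_one _)
  rw [e]
  rw [abs_le] at *
  constructor <;> linarith

lemma den_pos {p q : ℝ} (hp : 0 ≤ p) (hpq : 0 < p + q) (s : ℝ) : p + q ≤ p * Real.cosh s + q := by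
  nlinarith [Real.one_le_cosh s]

lemma osc_tail (x y p q d S : ℝ) (hx : 0 < x) (hp : 0 ≤ p) (hpq : 0 < p + q) (hd : 0 < d)
    (hdS : d ≤ S) :
    |∫ s in d..S, Real.cos (x * Real.cosh s + y) / (p * Real.cosh s + q)|
      ≤ 2 / (x * Real.sinh d * (p + q)) := by
  have hsp : ∀ s ∈ Set.Icc d S, 0 < Real.sinh s := fun s hs =>
    Real.sinh_pos_iff.2 (lt_of_lt_of_le hd hs.1)
  have hdp : ∀ s, 0 < p * Real.cosh s + q := fun s => lt_of_lt_of_le hpq (den_pos hp hpq s)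
  have key := osc_gen (fun s => x * Real.cosh s + y) (fun s => x * Real.sinh s)
    (fun s => (Real.sinh s * (p * Real.cosh s + q))⁻¹)
    (fun s => -(Real.cosh s * (p * Real.cosh s + q) + Real.sinh s * (p * Real.sinh s)) /
      (Real.sinh s * (p * Real.cosh s + q)) ^ 2) d S hdS
    (fun s => ((Real.hasDerivAt_cosh s).const_mul x).add_const y) (by fun_prop)
    (fun s hs => by
      have h1 := ((Real.hasDerivAt_sinh s).mul (((Real.hasDerivAt_cosh s).const_mul p).add_const q))
      exact h1.inv (mul_pos (hsp s hs) (hdp s)).ne')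
    (ContinuousOn.div (by fun_prop) (by fun_prop)
      (fun s hs => pow_ne_zero _ (mul_pos (hsp s hs) (hdp s)).ne'))
    (fun s hs => by
      have := hsp s hs
      have := hdp s
      have := Real.cosh_pos s
      rw [neg_div]
      simp only [Left.neg_nonpos_iff]
      positivity)
    (fun s hs => by
      have := hsp s hs
      have := hdp s
      positivity)
  have e : ∫ s in d..S, (Real.sinh s * (p * Real.cosh s + q))⁻¹ *
      (Real.cos (x * Real.cosh s + y) * (x * Real.sinh s))
      = x * ∫ s in d..S, Real.cos (x * Real.cosh s + y) / (p * Real.cosh s + q) := by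
    rw [← intervalIntegral.integral_const_mul]
    refine intervalIntegral.integral_congr fun s hs => ?_
    rw [Set.uIcc_of_le hdS] at hs
    have := (hsp s hs).ne'
    have := (hdp s).ne'
    try simp only
    field_simp
  simp only [e, abs_mul, abs_of_pos hx] at key
  have hsd := hsp d ⟨le_rfl, hdS⟩
  have k2 : (Real.sinh d * (p * Real.cosh d + q))⁻¹ ≤ (Real.sinh d * (p + q))⁻¹ := by
    have := den_pos hp hpq d
    gcongr
  rw [le_div_iff₀ (by positivity)]
  have k3 := key.trans (mul_le_mul_of_nonneg_left k2 zero_le_two)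
  rw [← div_eq_mul_inv, le_div_iff₀ (by positivity)] at k3
  linarith

lemma osc_full (x y p q d S : ℝ) (hx : 0 < x) (hp : 0 ≤ p) (hpq : 0 < p + q) (hd : 0 < d)
    (hdS : d ≤ S) :
    |∫ s in (0:ℝ)..S, Real.cos (x * Real.cosh s + y) / (p * Real.cosh s + q)|
      ≤ d / (p + q) + 2 / (x * Real.sinh d * (p + q)) := by
  have hdp : ∀ s, 0 < p * Real.cosh s + q := fun s => lt_of_lt_of_le hpq (den_pos hp hpq s)
  have hc : Continuous fun s => Real.cos (x * Real.cosh s + y) / (p * Real.cosh s + q) :=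
    Continuous.div (by fun_prop) (by fun_prop) fun s => (hdp s).ne'
  rw [← intervalIntegral.integral_add_adjacent_intervals (hc.intervalIntegrable 0 d)
    (hc.intervalIntegrable d S)]
  refine (abs_add_le _ _).trans (add_le_add ?_ (osc_tail x y p q d S hx hp hpq hd hdS))
  have := intervalIntegral.norm_integral_le_of_norm_le_const (a := 0) (b := d) (C := 1 / (p + q))
    (f := fun s => Real.cos (x * Real.cosh s + y) / (p * Real.cosh s + q)) (fun s _ => by
      rw [Real.norm_eq_abs, abs_div, abs_of_pos (hdp s)]
      have := den_pos hp hpq s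
      gcongr
      exact Real.abs_cos_le_one _)
  rw [sub_zero, abs_of_pos hd] at this
  refine this.trans (le_of_eq (by ring))

lemma tanh_lim : Tendsto (fun s : ℝ => Real.sinh s / Real.cosh s) atTop (𝓝 1) := by
  have h0 : Tendsto (fun s : ℝ => 1 - Real.exp (-s)) atTop (𝓝 1) := by
    have := Real.tendsto_exp_neg_atTop_nhds_zero.const_sub 1
    simpa using this
  refine tendsto_of_tendsto_of_tendsto_of_le_of_le h0 tendsto_const_nhds (fun s => ?_) (fun s => ?_)
  · have := Real.one_le_cosh s
    have e := Real.cosh_sub_sinh s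
    try simp only
    rw [le_div_iff₀ (by linarith)]
    nlinarith [Real.exp_pos (-s)]
  · have := Real.one_le_cosh s
    have e := Real.cosh_sub_sinh s
    try simp only
    rw [div_le_iff₀ (by linarith)]
    nlinarith [Real.exp_pos (-s)]

lemma main_lim (a b : ℝ) (ha : 0 ≤ a) (hab : a < b) :
    Tendsto (fun S : ℝ => ∫ s in (0:ℝ)..S, a / ((b * Real.cosh s) ^ 2 - a ^ 2)) atTop
      (𝓝 (Real.arcsin (a / b) / Real.sqrt (b ^ 2 - a ^ 2))) := by
  have hb : 0 < b := by linarith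
  have hk2 : 0 < b ^ 2 - a ^ 2 := by nlinarith
  set k := Real.sqrt (b ^ 2 - a ^ 2) with hk
  have hkpos : 0 < k := Real.sqrt_pos.2 hk2
  have hks : k ^ 2 = b ^ 2 - a ^ 2 := Real.sq_sqrt hk2.le
  have hden : ∀ s, 0 < (b * Real.cosh s) ^ 2 - a ^ 2 := fun s => by
    nlinarith [Real.one_le_cosh s, mul_le_mul_of_nonneg_left (Real.one_le_cosh s) hb.le]
  have harc : Real.arcsin (a / b) = Real.arctan (a / k * 1) := by
    rw [Real.arcsin_eq_arctan ⟨by have : 0 ≤ a / b := by positivity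
                                  linarith, (div_lt_one hb).2 hab⟩]
    congr 1
    have : 1 - (a / b) ^ 2 = (b ^ 2 - a ^ 2) / b ^ 2 := by field_simp
    rw [this, Real.sqrt_div hk2.le, Real.sqrt_sq hb.le, ← hk]
    field_simp
  have e : ∀ S : ℝ, ∫ s in (0:ℝ)..S, a / ((b * Real.cosh s) ^ 2 - a ^ 2)
      = Real.arctan (a / k * (Real.sinh S / Real.cosh S)) / k := by
    intro S
    rw [intervalIntegral.integral_eq_sub_of_hasDerivAt
      (f := fun S => Real.arctan (a / k * (Real.sinh S / Real.cosh S)) / k)]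
    · simp
    · intro s _
      have hc := (Real.cosh_pos s)
      have h := ((((Real.hasDerivAt_sinh s).div (Real.hasDerivAt_cosh s) hc.ne').const_mul
        (a / k)).arctan).div_const k
      refine h.congr_deriv ?_
      have h1 := Real.cosh_sq s
      have h3 := (hden s).ne'
      have h5 : k ^ 2 * Real.cosh s ^ 2 + a ^ 2 * Real.sinh s ^ 2
        = (b * Real.cosh s) ^ 2 - a ^ 2 := by
          linear_combination Real.cosh s ^ 2 * hks - a ^ 2 * h1
      have h4 : Real.cosh s * Real.cosh s - Real.sinh s * Real.sinh s = 1 := by linarith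
      simp only [Pi.div_apply]
      rw [h4, ← h5]
      rw [← h5] at h3
      field_simp
    · exact (Continuous.div (by fun_prop) (by fun_prop) fun s => (hden s).ne').intervalIntegrable _ _
  simp only [e]
  rw [harc]
  exact ((Real.continuous_arctan.tendsto _).comp (tanh_lim.const_mul _)).div_const k

lemma inner_eq (a c T : ℝ) (h1 : 0 < c + a) (h2 : 0 < c - a) :
    ∫ t in (0:ℝ)..T, Real.sin (a * t) * Real.cos (c * t)
      = - (a / (c ^ 2 - a ^ 2)) - 1 / 2 * (Real.cos ((c + a) * T) / (c + a))
        + 1 / 2 * (Real.cos ((c - a) * T) / (c - a)) := by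
  rw [intervalIntegral.integral_eq_sub_of_hasDerivAt
      (f := fun t => - (1 / 2 * (Real.cos ((c + a) * t) / (c + a)))
        + 1 / 2 * (Real.cos ((c - a) * t) / (c - a)))]
  · have : c ^ 2 - a ^ 2 ≠ 0 := by nlinarith [mul_pos h1 h2]
    simp only [mul_zero, Real.cos_zero]
    have e : a / (c ^ 2 - a ^ 2) = 1 / 2 * (1 / (c - a)) - 1 / 2 * (1 / (c + a)) := by
      have := h1.ne'
      have := h2.ne'
      rw [show c ^ 2 - a ^ 2 = (c - a) * (c + a) by ring]
      field_simp
      ring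
    rw [e]
    ring
  · intro t _
    have d1 := ((((hasDerivAt_id t).const_mul (c + a)).cos.div_const (c + a)).const_mul (1 / 2)).neg
    have d2 := ((((hasDerivAt_id t).const_mul (c - a)).cos.div_const (c - a)).const_mul (1 / 2))
    refine (d1.add d2).congr_deriv ?_
    have := h1.ne'
    have := h2.ne'
    simp only [id]
    rw [show (c + a) * t = c * t + a * t by ring, show (c - a) * t = c * t - a * t by ring,
      Real.sin_add, Real.sin_sub]
    field_simp
    ring
  · exact Continuous.intervalIntegrable (by fun_prop) _ _

lemma swap_eq (a b T S : ℝ) (ha : 0 ≤ a) (hab : a < b) :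
    ∫ t in (0:ℝ)..T, Real.sin (a * t) * ∫ s in (0:ℝ)..S, Real.cos (b * t * Real.cosh s)
      = - (∫ s in (0:ℝ)..S, a / ((b * Real.cosh s) ^ 2 - a ^ 2))
        - 1 / 2 * (∫ s in (0:ℝ)..S, Real.cos (b * T * Real.cosh s + a * T) / (b * Real.cosh s + a))
        + 1 / 2 * (∫ s in (0:ℝ)..S,
            Real.cos (b * T * Real.cosh s + -(a * T)) / (b * Real.cosh s + -a)) := by
  have hb : 0 < b := by linarith
  have hp1 : ∀ s, 0 < b * Real.cosh s + a := fun s => by nlinarith [Real.one_le_cosh s]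
  have hp2 : ∀ s, 0 < b * Real.cosh s + -a := fun s => by nlinarith [Real.one_le_cosh s]
  have hden : ∀ s, (b * Real.cosh s) ^ 2 - a ^ 2 ≠ 0 := fun s => by
    nlinarith [mul_pos (hp1 s) (hp2 s)]
  simp only [← intervalIntegral.integral_const_mul]
  rw [MeasureTheory.intervalIntegral_intervalIntegral_swap]
  · rw [← intervalIntegral.integral_neg, ← intervalIntegral.integral_sub,
      ← intervalIntegral.integral_add]
    · refine intervalIntegral.integral_congr fun s _ => ?_
      have := inner_eq a (b * Real.cosh s) T (hp1 s) (by linarith [hp2 s])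
      try simp only
      rw [show b * T * Real.cosh s + a * T = (b * Real.cosh s + a) * T by ring,
        show b * T * Real.cosh s + -(a * T) = (b * Real.cosh s - a) * T by ring,
        ← sub_eq_add_neg, ← this]
      refine intervalIntegral.integral_congr fun t _ => ?_
      try simp only
      congr 2
      ring
    · refine Continuous.intervalIntegrable ?_ _ _
      refine Continuous.sub (Continuous.neg ?_) (Continuous.mul continuous_const ?_)
      · exact Continuous.div (by fun_prop) (by fun_prop) hden
      · exact Continuous.div (by fun_prop) (by fun_prop) fun s => (hp1 s).ne'
    · refine Continuous.intervalIntegrable (Continuous.mul continuous_const ?_) _ _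
      exact Continuous.div (by fun_prop) (by fun_prop) fun s => (hp2 s).ne'
    · refine Continuous.intervalIntegrable (Continuous.neg ?_) _ _
      exact Continuous.div (by fun_prop) (by fun_prop) hden
    · refine Continuous.intervalIntegrable (Continuous.mul continuous_const ?_) _ _
      exact Continuous.div (by fun_prop) (by fun_prop) fun s => (hp1 s).ne'
  · have hc : Continuous (Function.uncurry fun t s : ℝ =>
        Real.sin (a * t) * Real.cos (b * t * Real.cosh s)) := by
      unfold Function.uncurry; fun_prop
    exact (hc.continuousOn.integrableOn_compact
      (isCompact_uIcc.prod isCompact_uIcc)).mono_set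
        (Set.prod_mono Set.uIoc_subset_uIcc Set.uIoc_subset_uIcc)

theorem stmt_11 (Y0 : ℝ → ℝ)
    (hY0 : ∀ x : ℝ, 0 < x →
      Tendsto (fun S : ℝ => ∫ s in (0:ℝ)..S, Real.cos (x * Real.cosh s))
        atTop (𝓝 (-(π / 2) * Y0 x)))
    (a b : ℝ) (ha : 0 ≤ a) (hab : a < b) :
    Tendsto (fun T : ℝ => ∫ t in (0:ℝ)..T, Real.sin (a * t) * Y0 (b * t))
      atTop (𝓝 ((2 / π) * Real.arcsin (a / b) / Real.sqrt (b ^ 2 - a ^ 2))) := by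
  have hb : 0 < b := by linarith
  have hba : 0 < b - a := by linarith
  set L := Real.arcsin (a / b) / Real.sqrt (b ^ 2 - a ^ 2) with hL
  set F : ℝ → ℝ := fun T => ∫ t in (0:ℝ)..T, Real.sin (a * t) * Y0 (b * t) with hF
  have hsinh1 : 1 ≤ Real.sinh 1 := Real.self_le_sinh_iff.2 zero_le_one
  have dom : ∀ T : ℝ, 0 < T → Tendsto (fun S : ℝ => ∫ t in (0:ℝ)..T,
      Real.sin (a * t) * ∫ s in (0:ℝ)..S, Real.cos (b * t * Real.cosh s)) atTop
      (𝓝 (-(π / 2) * F T)) := by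
    intro T hT
    rw [hF]
    try simp only
    rw [← intervalIntegral.integral_const_mul]
    refine intervalIntegral.tendsto_integral_filter_of_dominated_convergence
      (fun _ => a * T + 2 * a / b) ?_ ?_ (by simp) ?_
    · refine Eventually.of_forall fun S => Continuous.aestronglyMeasurable ?_
      refine Continuous.mul (by fun_prop) ?_
      refine intervalIntegral.continuous_parametric_intervalIntegral_of_continuous' ?_ _ _
      unfold Function.uncurry; fun_prop
    · filter_upwards [eventually_ge_atTop 1] with S hS
      refine Eventually.of_forall fun t ht => ?_
      rw [Set.uIoc_of_le hT.le] at ht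
      have ht0 := ht.1
      have k := osc_full (b * t) 0 0 1 1 S (by positivity) le_rfl (by norm_num) one_pos hS
      simp only [add_zero, zero_mul, zero_add, div_one, mul_one] at k
      rw [norm_mul, Real.norm_eq_abs, Real.norm_eq_abs]
      have k1 : |Real.sin (a * t)| ≤ a * t := by
        have := Real.abs_sin_le_abs (x := a * t)
        rwa [abs_of_nonneg (by positivity : 0 ≤ a * t)] at this
      have k2 : 2 / (b * t * Real.sinh 1) ≤ 2 / (b * t) := by
        exact div_le_div_of_nonneg_left zero_le_two (by positivity)
          (le_mul_of_one_le_right (by positivity) hsinh1)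
      calc _ ≤ (a * t) * (1 + 2 / (b * t)) := by
            apply mul_le_mul k1 (by linarith) (abs_nonneg _) (by positivity)
        _ = a * t + 2 * a / b := by field_simp
        _ ≤ _ := by have := ht.2; gcongr
    · refine Eventually.of_forall fun t ht => ?_
      rw [Set.uIoc_of_le hT.le] at ht
      have := (hY0 (b * t) (mul_pos hb ht.1)).const_mul (Real.sin (a * t))
      convert this using 2
      ring
  have bound : ∀ T : ℝ, 0 < T → |-(π / 2) * F T + L| ≤ (1 + 2 / b) / (b - a) * (√T)⁻¹ := by
    intro T hT
    have h1 := ((dom T hT).add (main_lim a b ha hab)).abs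
    refine le_of_tendsto h1 ?_
    have hd : 0 < (√T)⁻¹ := inv_pos.2 (Real.sqrt_pos.2 hT)
    filter_upwards [eventually_ge_atTop (√T)⁻¹] with S hS
    rw [swap_eq a b T S ha hab]
    have hP := osc_full (b * T) (a * T) b a _ S (by positivity) hb.le (by linarith) hd hS
    have hM := osc_full (b * T) (-(a * T)) b (-a) _ S (by positivity) hb.le (by linarith) hd hS
    have gen : ∀ w, b - a ≤ w → (√T)⁻¹ / w + 2 / (b * T * Real.sinh (√T)⁻¹ * w)
        ≤ (1 + 2 / b) / (b - a) * (√T)⁻¹ := by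
      intro w hw
      have hs : (√T)⁻¹ ≤ Real.sinh (√T)⁻¹ := Real.self_le_sinh_iff.2 hd.le
      calc _ ≤ (√T)⁻¹ / (b - a) + 2 / (b * T * (√T)⁻¹ * (b - a)) := by gcongr
        _ = _ := by
          have hs2 : √T ^ 2 = T := Real.sq_sqrt hT.le
          have hs0 : √T ≠ 0 := (Real.sqrt_pos.2 hT).ne'
          generalize √T = r at *
          subst hs2
          field_simp
    have gP := hP.trans (gen _ (by linarith))
    have gM := hM.trans (gen _ (by linarith))
    rw [abs_le] at *
    constructor <;> linarith [gP.1, gP.2, gM.1, gM.2]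
  have lim0 : Tendsto (fun T => -(π / 2) * F T + L) atTop (𝓝 0) := by
    have hz : Tendsto (fun T : ℝ => (1 + 2 / b) / (b - a) * (√T)⁻¹) atTop (𝓝 0) := by
      have := (tendsto_inv_atTop_zero.comp Real.tendsto_sqrt_atTop).const_mul
        ((1 + 2 / b) / (b - a))
      simpa using this
    refine squeeze_zero_norm' ?_ hz
    filter_upwards [eventually_gt_atTop 0] with T hT
    exact bound T hT
  have fin := (lim0.sub_const L).const_mul (-(2 / π))
  have hpi := Real.pi_ne_zero
  convert fin using 2
  · field_simp
    ring
  · rw [hL]; ring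
end

section
/- Let a, b ∈ ℝ with |a| < b. Then the improper integral ∫₀^∞ ( cos(ak) J₀(bk) − sin(ak) Y₀(bk) ) dk converges and equals ( 1 − (2/π) arcsin(a/b) ) / √(b² − a²). -/
open Real Filter Topology

theorem aux_contour (x S : ℝ) :
    (∫ s in (0:ℝ)..S, Complex.exp (Complex.I * x * Complex.cosh s)) =
      Complex.I * (∫ y in (0:ℝ)..(π/2), Complex.exp (Complex.I * x * Complex.cos y))
      + (∫ s in (0:ℝ)..S, Complex.exp (-(x * Complex.sinh s)))
      - Complex.I * (∫ y in (0:ℝ)..(π/2), Complex.exp (Complex.I * x * Complex.cosh (S + y * Complex.I))) := by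
  have h := Complex.integral_boundary_rect_eq_zero_of_differentiableOn
    (fun z => Complex.exp (Complex.I * x * Complex.cosh z)) 0 (S + (π/2 : ℝ) * Complex.I)
    (by fun_prop)
  simp only [Complex.zero_re, Complex.zero_im, Complex.add_re, Complex.add_im, Complex.ofReal_re,
    Complex.ofReal_im, Complex.mul_re, Complex.mul_im, Complex.I_re, Complex.I_im, mul_zero,
    mul_one, zero_mul, sub_zero, add_zero, zero_add, Complex.ofReal_zero, smul_eq_mul,
    Complex.cosh_mul_I] at h
  have e : ∀ s : ℝ, Complex.I * x * Complex.cosh (s + (π/2 : ℝ) * Complex.I) = -(x * Complex.sinh s) := by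
    intro s
    rw [Complex.cosh_add, Complex.cosh_mul_I, Complex.sinh_mul_I]
    rw [← Complex.ofReal_cos, ← Complex.ofReal_sin]
    simp only [Real.cos_pi_div_two, Real.sin_pi_div_two, Complex.ofReal_zero, Complex.ofReal_one]
    linear_combination (x * Complex.sinh s) * Complex.I_mul_I
  simp only [e] at h
  linear_combination h

theorem aux_norm (x S y : ℝ) :
    ‖Complex.exp (Complex.I * x * Complex.cosh (S + y * Complex.I))‖
      = Real.exp (-(x * (Real.sinh S * Real.sin y))) := by
  rw [Complex.norm_exp, Complex.cosh_add, Complex.cosh_mul_I, Complex.sinh_mul_I]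
  rw [← Complex.ofReal_cos, ← Complex.ofReal_sin, ← Complex.ofReal_cosh, ← Complex.ofReal_sinh]
  congr 1
  simp only [Complex.mul_re, Complex.mul_im, Complex.add_re, Complex.add_im, Complex.I_re, Complex.I_im,
    Complex.ofReal_re, Complex.ofReal_im]
  ring

theorem aux_norm' (x y : ℝ) :
    ‖Complex.exp (Complex.I * x * Complex.cos y)‖ = 1 := by
  rw [Complex.norm_exp, ← Complex.ofReal_cos]
  simp

theorem aux_normle (x S y : ℝ) (hx : 0 < x) (hS : 0 ≤ S) (hy : y ∈ Set.uIoc 0 (π/2)) :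
    ‖Complex.exp (Complex.I * x * Complex.cosh (S + y * Complex.I))‖ ≤ 1 := by
  rw [aux_norm, Real.exp_le_one_iff]
  rw [Set.uIoc_of_le (by positivity)] at hy
  have := Real.sin_nonneg_of_nonneg_of_le_pi hy.1.le (by linarith [hy.2, Real.pi_pos])
  have := Real.sinh_nonneg_iff.2 hS
  have : 0 ≤ x * (Real.sinh S * Real.sin y) := by positivity
  linarith

theorem aux_Q_tendsto (x : ℝ) (hx : 0 < x) :
    Tendsto (fun S : ℝ => ∫ y in (0:ℝ)..(π/2), Complex.exp (Complex.I * x * Complex.cosh (S + y * Complex.I)))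
      atTop (𝓝 0) := by
  have := intervalIntegral.tendsto_integral_filter_of_dominated_convergence (μ := MeasureTheory.volume)
    (a := 0) (b := π/2) (l := atTop)
    (F := fun S y : ℝ => Complex.exp (Complex.I * x * Complex.cosh (S + y * Complex.I)))
    (f := fun _ => (0:ℂ)) (fun _ => (1:ℝ)) ?_ ?_ ?_ ?_
  · simpa using this
  · refine Eventually.of_forall fun S => Continuous.aestronglyMeasurable (by fun_prop)
  · filter_upwards [eventually_ge_atTop 0] with S hS
    exact Eventually.of_forall fun y hy => aux_normle x S y hx hS hy
  · simp
  · refine Eventually.of_forall fun y hy => ?_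
    rw [tendsto_zero_iff_norm_tendsto_zero]
    simp only [aux_norm]
    rw [Set.uIoc_of_le (by positivity)] at hy
    have hs := Real.sin_pos_of_pos_of_lt_pi hy.1 (by linarith [hy.2, Real.pi_pos])
    apply Real.tendsto_exp_neg_atTop_nhds_zero.comp
    apply Tendsto.const_mul_atTop hx
    apply Tendsto.atTop_mul_const hs
    refine tendsto_atTop_mono' _ ?_ tendsto_id
    filter_upwards [eventually_ge_atTop 0] with S hS
    exact Real.self_le_sinh_iff.2 hS

theorem aux_re (x S : ℝ) : (∫ s in (0:ℝ)..S, Complex.exp (Complex.I * x * Complex.cosh s)).re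
    = ∫ s in (0:ℝ)..S, Real.cos (x * Real.cosh s) := by
  have hi : IntervalIntegrable (fun s : ℝ => Complex.exp (Complex.I * x * Complex.cosh s)) MeasureTheory.volume 0 S :=
    Continuous.intervalIntegrable (by fun_prop) _ _
  have := Complex.reCLM.intervalIntegral_comp_comm hi
  rw [← Complex.reCLM_apply, ← this]
  refine intervalIntegral.integral_congr fun s _ => ?_
  simp only [Complex.reCLM_apply, Complex.exp_re, ← Complex.ofReal_cosh]
  simp

theorem aux_im (x S : ℝ) : (∫ s in (0:ℝ)..S, Complex.exp (Complex.I * x * Complex.cosh s)).im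
    = ∫ s in (0:ℝ)..S, Real.sin (x * Real.cosh s) := by
  have hi : IntervalIntegrable (fun s : ℝ => Complex.exp (Complex.I * x * Complex.cosh s)) MeasureTheory.volume 0 S :=
    Continuous.intervalIntegrable (by fun_prop) _ _
  have := Complex.imCLM.intervalIntegral_comp_comm hi
  rw [← Complex.imCLM_apply, ← this]
  refine intervalIntegral.integral_congr fun s _ => ?_
  simp only [Complex.imCLM_apply, Complex.exp_im, ← Complex.ofReal_cosh]
  simp

theorem aux_P_re (x : ℝ) : (∫ y in (0:ℝ)..(π/2), Complex.exp (Complex.I * x * Complex.cos y)).re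
    = ∫ y in (0:ℝ)..(π/2), Real.cos (x * Real.cos y) := by
  have hi : IntervalIntegrable (fun s : ℝ => Complex.exp (Complex.I * x * Complex.cos s)) MeasureTheory.volume 0 (π/2) :=
    Continuous.intervalIntegrable (by fun_prop) _ _
  have := Complex.reCLM.intervalIntegral_comp_comm hi
  rw [← Complex.reCLM_apply, ← this]
  refine intervalIntegral.integral_congr fun s _ => ?_
  simp only [Complex.reCLM_apply, Complex.exp_re, ← Complex.ofReal_cos]
  simp only [Complex.mul_re, Complex.mul_im, Complex.I_re, Complex.I_im,
    Complex.ofReal_re, Complex.ofReal_im]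
  simp

theorem aux_expint (x S : ℝ) : (∫ s in (0:ℝ)..S, Complex.exp (-(x * Complex.sinh s)))
   = ((∫ s in (0:ℝ)..S, Real.exp (-(x * Real.sinh s)) : ℝ) : ℂ) := by
  rw [← intervalIntegral.integral_ofReal]
  push_cast
  rfl

theorem aux_expint_le (x S : ℝ) (hx : 0 < x) (hS : 0 ≤ S) :
    |∫ s in (0:ℝ)..S, Real.exp (-(x * Real.sinh s))| ≤ 1 / x := by
  rw [abs_of_nonneg (intervalIntegral.integral_nonneg hS fun _ _ => (Real.exp_pos _).le)]
  calc _ ≤ ∫ s in (0:ℝ)..S, Real.exp (-(x * s)) := by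
        apply intervalIntegral.integral_mono_on hS
        · exact Continuous.intervalIntegrable (by fun_prop) _ _
        · exact Continuous.intervalIntegrable (by fun_prop) _ _
        · intro s hs
          have := Real.self_le_sinh_iff.2 hs.1
          gcongr
    _ = (1 - Real.exp (-(x * S))) / x := by
        rw [intervalIntegral.integral_eq_sub_of_hasDerivAt (f := fun s => -(Real.exp (-(x * s)) / x))]
        · simp; ring
        · intro s _
          have := (((hasDerivAt_id s).const_mul x).neg.exp.div_const x).neg
          refine this.congr_deriv ?_
          simp only [Pi.neg_apply, id]
          field_simp
        · exact Continuous.intervalIntegrable (by fun_prop) _ _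
    _ ≤ 1 / x := by
        gcongr
        linarith [Real.exp_pos (-(x * S))]

theorem aux_im_eq (x S : ℝ) : (∫ s in (0:ℝ)..S, Real.sin (x * Real.cosh s)) =
    (∫ y in (0:ℝ)..(π/2), Real.cos (x * Real.cos y)) -
    (∫ y in (0:ℝ)..(π/2), Complex.exp (Complex.I * x * Complex.cosh (S + y * Complex.I))).re := by
  rw [← aux_im, aux_contour, ← aux_P_re, aux_expint]
  simp

theorem aux_Q_le (x S : ℝ) (hx : 0 < x) (hS : 0 ≤ S) :
    ‖∫ y in (0:ℝ)..(π/2), Complex.exp (Complex.I * x * Complex.cosh (S + y * Complex.I))‖ ≤ π/2 := by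
  have := intervalIntegral.norm_integral_le_of_norm_le_const (fun y hy => aux_normle x S y hx hS hy)
  rwa [one_mul, sub_zero, abs_of_pos (by positivity)] at this

theorem aux_P_le (x : ℝ) :
    ‖∫ y in (0:ℝ)..(π/2), Complex.exp (Complex.I * x * Complex.cos y)‖ ≤ π/2 := by
  have := intervalIntegral.norm_integral_le_of_norm_le_const (a := 0) (b := π/2) (fun y (hy : y ∈ Set.uIoc 0 (π/2)) => (aux_norm' x y).le)
  rwa [one_mul, sub_zero, abs_of_pos (by positivity)] at this

theorem aux_im_le (x S : ℝ) (hx : 0 < x) (hS : 0 ≤ S) :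
    |∫ s in (0:ℝ)..S, Real.sin (x * Real.cosh s)| ≤ π := by
  rw [aux_im_eq, ← aux_P_re]
  have h1 := (Complex.abs_re_le_norm _).trans (aux_P_le x)
  have h2 := (Complex.abs_re_le_norm _).trans (aux_Q_le x S hx hS)
  refine (abs_sub _ _).trans ?_
  linarith

theorem aux_re_le (x S : ℝ) (hx : 0 < x) (hS : 0 ≤ S) :
    |∫ s in (0:ℝ)..S, Real.cos (x * Real.cosh s)| ≤ π + 1 / x := by
  rw [← aux_re, aux_contour, aux_expint]
  have h1 := (Complex.abs_im_le_norm _).trans (aux_P_le x)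
  have h2 := (Complex.abs_im_le_norm _).trans (aux_Q_le x S hx hS)
  have h3 := aux_expint_le x S hx hS
  simp only [Complex.sub_re, Complex.add_re, Complex.I_mul_re, Complex.ofReal_re]
  rw [abs_le] at *
  constructor <;> linarith


theorem aux_J0 (x : ℝ) : (∫ y in (0:ℝ)..(π/2), Real.cos (x * Real.cos y)) = π / 2 * J0 x := by
  have hc : ∀ u v, IntervalIntegrable (fun t => Real.cos (x * Real.sin t)) MeasureTheory.volume u v :=
    fun u v => Continuous.intervalIntegrable (by fun_prop) _ _
  have h1 : (∫ y in (0:ℝ)..(π/2), Real.cos (x * Real.cos y)) = ∫ t in (0:ℝ)..(π/2), Real.cos (x * Real.sin t) := by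
    have := intervalIntegral.integral_comp_sub_left (a := 0) (b := π/2) (fun t => Real.cos (x * Real.sin t)) (π/2)
    simpa [Real.sin_pi_div_two_sub] using this
  have h2 : (∫ y in (0:ℝ)..(π/2), Real.cos (x * Real.sin y)) = ∫ t in (π/2)..π, Real.cos (x * Real.sin t) := by
    have := intervalIntegral.integral_comp_sub_left (a := 0) (b := π/2) (fun t => Real.cos (x * Real.sin t)) π
    simp only [Real.sin_pi_sub] at this
    rw [this]; congr 1 <;> ring
  have h3 := intervalIntegral.integral_add_adjacent_intervals (hc 0 (π/2)) (hc (π/2) π)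
  rw [J0, ← h3, ← h2, h1]
  field_simp
  ring

theorem aux_im_tendsto (x : ℝ) (hx : 0 < x) :
    Tendsto (fun S : ℝ => ∫ s in (0:ℝ)..S, Real.sin (x * Real.cosh s)) atTop (𝓝 (π/2 * J0 x)) := by
  simp only [aux_im_eq, aux_J0]
  have := (Complex.continuous_re.tendsto 0).comp (aux_Q_tendsto x hx)
  simpa using this.const_sub (π/2 * J0 x)


theorem aux_angle (a b : ℝ) (hab : |a| < b) :
    2 * Real.arctan ((a + b) / Real.sqrt (b ^ 2 - a ^ 2)) = π / 2 + Real.arcsin (a / b) := by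
  have hb : 0 < b := (abs_nonneg a).trans_lt hab
  obtain ⟨h1, h2⟩ := abs_lt.1 hab
  have hR : 0 < b ^ 2 - a ^ 2 := by nlinarith
  have l1 : -1 < a / b := by rw [lt_div_iff₀ hb]; linarith
  have l2 : a / b < 1 := by rw [div_lt_one hb]; exact h2
  set φ := Real.arcsin (a / b) with hφ
  have p1 : -(π/2) < φ := Real.neg_pi_div_two_lt_arcsin.2 l1
  have p2 : φ < π/2 := Real.arcsin_lt_pi_div_two.2 l2
  have hs : Real.sin φ = a / b := Real.sin_arcsin l1.le l2.le
  have hc : Real.cos φ = Real.sqrt (b^2 - a^2) / b := by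
    rw [hφ, Real.cos_arcsin, show 1 - (a/b)^2 = (b^2 - a^2) / b^2 by field_simp,
      Real.sqrt_div hR.le, Real.sqrt_sq hb.le]
  set ψ := π/4 + φ/2 with hψ
  have q1 : 0 < ψ := by linarith
  have q2 : ψ < π/2 := by linarith
  have ht : (a + b) / Real.sqrt (b ^ 2 - a ^ 2) = Real.tan ψ := by
    have hcp : 0 < Real.cos ψ := Real.cos_pos_of_mem_Ioo ⟨by linarith, q2⟩
    have hsp : 0 < Real.sin ψ := Real.sin_pos_of_pos_of_lt_pi q1 (by linarith)
    have e1 : Real.sqrt (b^2 - a^2) = b * (2 * Real.sin ψ * Real.cos ψ) := by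
      rw [← Real.sin_two_mul, show 2 * ψ = φ + π/2 by rw [hψ]; ring, Real.sin_add_pi_div_two, hc]
      field_simp
    have e2 : a + b = b * (2 * Real.sin ψ ^ 2) := by
      have : Real.sin φ = - Real.cos (2 * ψ) := by
        rw [show 2 * ψ = φ + π/2 by rw [hψ]; ring, Real.cos_add_pi_div_two]; ring
      rw [Real.cos_two_mul, hs, Real.cos_sq'] at this
      field_simp at this
      linarith
    rw [e1, e2, Real.tan_eq_sin_div_cos]
    field_simp
  rw [ht, Real.arctan_tan (by linarith) q2, hψ]; ring

theorem aux_pos (a b s : ℝ) (hab : |a| < b) : 0 < a + b * Real.cosh s := by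
  have hb : 0 < b := (abs_nonneg a).trans_lt hab
  obtain ⟨h1, h2⟩ := abs_lt.1 hab
  nlinarith [Real.one_le_cosh s]

theorem aux_base (a b : ℝ) (hab : |a| < b) :
    MeasureTheory.IntegrableOn (fun s => 1 / (a + b * Real.cosh s)) (Set.Ioi 0) ∧
    ∫ s in Set.Ioi (0:ℝ), 1 / (a + b * Real.cosh s) =
      (π / 2 - Real.arcsin (a / b)) / Real.sqrt (b ^ 2 - a ^ 2) := by
  have hb : 0 < b := (abs_nonneg a).trans_lt hab
  obtain ⟨h1, h2⟩ := abs_lt.1 hab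
  have hR2 : 0 < b ^ 2 - a ^ 2 := by nlinarith
  set R := Real.sqrt (b^2 - a^2) with hRdef
  have hR : 0 < R := Real.sqrt_pos.2 hR2
  have hRR : R ^ 2 = b^2 - a^2 := Real.sq_sqrt hR2.le
  set F : ℝ → ℝ := fun s => 2 / R * Real.arctan ((b * Real.exp s + a) / R) with hF
  have hd : ∀ s, HasDerivAt F (1 / (a + b * Real.cosh s)) s := by
    intro s
    have := (((((Real.hasDerivAt_exp s).const_mul b).add_const a).div_const R).arctan).const_mul (2 / R)
    refine this.congr_deriv ?_
    have hp := aux_pos a b s hab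
    have hp' : 0 < R ^ 2 + (b * Real.exp s + a) ^ 2 := by positivity
    have he : Real.exp s * Real.exp (-s) = 1 := by rw [← Real.exp_add]; simp
    have e0 : 0 < Real.exp s := Real.exp_pos s
    have hk : R ^ 2 + (b * Real.exp s + a) ^ 2 = 2 * b * Real.exp s * (a + b * Real.cosh s) := by
      rw [hRR, Real.cosh_eq]
      linear_combination (-b^2) * he
    have : 1 + ((b * Real.exp s + a) / R) ^ 2 = 2 * b * Real.exp s * (a + b * Real.cosh s) / R ^ 2 := by
      rw [← hk]; field_simp
    rw [this]
    field_simp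
  have hlim : Tendsto F atTop (𝓝 (2 / R * (π / 2))) := by
    apply Tendsto.const_mul
    apply (Real.tendsto_arctan_atTop.mono_right nhdsWithin_le_nhds).comp
    apply Tendsto.atTop_div_const hR
    apply tendsto_atTop_add_const_right
    exact Real.tendsto_exp_atTop.const_mul_atTop hb
  have hc : ContinuousWithinAt F (Set.Ici 0) 0 := (hd 0).continuousAt.continuousWithinAt
  have hn : ∀ s ∈ Set.Ioi (0:ℝ), 0 ≤ 1 / (a + b * Real.cosh s) := fun s _ =>
    (one_div_pos.2 (aux_pos a b s hab)).le
  refine ⟨MeasureTheory.integrableOn_Ioi_deriv_of_nonneg hc (fun s _ => hd s) hn hlim, ?_⟩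
  rw [MeasureTheory.integral_Ioi_of_hasDerivAt_of_nonneg hc (fun s _ => hd s) hn hlim]
  have := aux_angle a b hab
  rw [← hRdef] at this
  have hF0 : F 0 = (π / 2 + Real.arcsin (a / b)) / R := by
    rw [← this, hF]; simp [add_comm a b]; ring
  rw [hF0]; ring

theorem aux_RL (a b : ℝ) (hab : |a| < b) :
    Tendsto (fun w : ℝ => ∫ s in Set.Ioi (0:ℝ), Real.fourierChar (-(Real.cosh s * w)) •
      ((1 / (a + b * Real.cosh s) : ℝ) : ℂ)) (cocompact ℝ) (𝓝 0) := by
  set A := Set.image Real.cosh (Set.Ioi (0:ℝ)) with hA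
  set g : ℝ → ℂ := fun v => ((1 / ((a + b * v) * Real.sqrt (v^2 - 1)) : ℝ) : ℂ) with hg
  have hinj : Set.InjOn Real.cosh (Set.Ioi 0) := Real.cosh_injOn.mono Set.Ioi_subset_Ici_self
  have hder : ∀ x ∈ Set.Ioi (0:ℝ), HasDerivWithinAt Real.cosh (Real.sinh x) (Set.Ioi 0) x :=
    fun x _ => (Real.hasDerivAt_cosh x).hasDerivWithinAt
  have hAm : MeasurableSet A :=
    measurableSet_Ioi.image_of_continuousOn_injOn Real.continuous_cosh.continuousOn hinj
  refine (Real.tendsto_integral_exp_smul_cocompact (A.indicator g)).congr fun w => ?_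
  have : (fun v : ℝ => Real.fourierChar (-(v * w)) • A.indicator g v)
      = A.indicator (fun v => Real.fourierChar (-(v * w)) • g v) := by
    ext v
    by_cases hv : v ∈ A <;> simp [hv]
  rw [this, MeasureTheory.integral_indicator hAm, hA,
    MeasureTheory.integral_image_eq_integral_abs_deriv_smul measurableSet_Ioi hder hinj]
  refine MeasureTheory.setIntegral_congr_fun measurableSet_Ioi fun s hs => ?_
  have hs' : 0 < Real.sinh s := Real.sinh_pos_iff.2 hs
  have hp := aux_pos a b s hab
  simp only [hg]
  rw [smul_comm]
  congr 1
  rw [Real.cosh_sq s, add_sub_cancel_right, Real.sqrt_sq hs'.le, abs_of_pos hs', Complex.real_smul,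
    ← Complex.ofReal_mul]
  congr 1
  field_simp

theorem aux_RL' (a b : ℝ) (hab : |a| < b) :
    Tendsto (fun T : ℝ => ∫ s in Set.Ioi (0:ℝ), Real.cos (T * (a + b * Real.cosh s)) *
      (1 / (a + b * Real.cosh s))) atTop (𝓝 0) := by
  have hb : 0 < b := (abs_nonneg a).trans_lt hab
  have hint := (aux_base a b hab).1
  have h1 : Tendsto (fun T : ℝ => T * (b / (2 * π))) atTop (cocompact ℝ) :=
    (tendsto_id.atTop_mul_const (by positivity)).mono_right atTop_le_cocompact
  have h2 := ((aux_RL a b hab).comp h1).norm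
  rw [norm_zero] at h2
  refine squeeze_zero_norm (fun T => ?_) h2
  set E : ℝ → ℂ := fun s => Real.fourierChar (-(Real.cosh s * (T * (b / (2 * π))))) •
      ((1 / (a + b * Real.cosh s) : ℝ) : ℂ) with hE
  have hEint : MeasureTheory.IntegrableOn E (Set.Ioi 0) := by
    refine MeasureTheory.Integrable.mono' hint (Continuous.aestronglyMeasurable ?_) ?_
    · have : ∀ s, a + b * Real.cosh s ≠ 0 := fun s => (aux_pos a b s hab).ne'
      simp only [hE]
      simp only [Circle.smul_def]
      fun_prop (disch := exact this _)
    · refine Eventually.of_forall fun s => ?_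
      have := aux_pos a b s hab
      simp only [hE, Circle.smul_def, norm_smul, Circle.norm_coe, one_mul, Complex.norm_real]
      rw [Real.norm_of_nonneg (by positivity)]
  have key : (∫ s in Set.Ioi (0:ℝ), Real.cos (T * (a + b * Real.cosh s)) *
      (1 / (a + b * Real.cosh s))) = (Complex.exp (-(T * a : ℝ) * Complex.I) * ∫ s in Set.Ioi (0:ℝ), E s).re := by
    rw [← MeasureTheory.integral_const_mul, ← Complex.reCLM_apply,
      ← Complex.reCLM.integral_comp_comm (hEint.const_mul _)]
    refine MeasureTheory.setIntegral_congr_fun measurableSet_Ioi fun s hs => ?_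
    simp only [hE, Circle.smul_def, Real.fourierChar_apply, Complex.reCLM_apply, smul_eq_mul]
    rw [← mul_assoc, ← Complex.exp_add, Complex.re_mul_ofReal]
    congr 1
    rw [← Complex.ofReal_neg, ← add_mul, ← Complex.ofReal_add, Complex.exp_ofReal_mul_I_re, ← Real.cos_neg]
    congr 1
    field_simp
    ring
  rw [key, Real.norm_eq_abs]
  refine (Complex.abs_re_le_norm _).trans ?_
  rw [norm_mul, ← Complex.ofReal_neg, Complex.norm_exp_ofReal_mul_I, one_mul]
  rfl

theorem aux_swap (f : ℝ → ℝ → ℝ) (hf : Continuous (Function.uncurry f)) (S T : ℝ) (hS : 0 ≤ S) (hT : 0 ≤ T) :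
    (∫ k in (0:ℝ)..T, ∫ s in (0:ℝ)..S, f k s) = ∫ s in (0:ℝ)..S, ∫ k in (0:ℝ)..T, f k s := by
  simp only [intervalIntegral.integral_of_le hS, intervalIntegral.integral_of_le hT]
  apply MeasureTheory.integral_integral_swap
  rw [MeasureTheory.Measure.prod_restrict]
  have : MeasureTheory.IntegrableOn (Function.uncurry f) (Set.Icc 0 T ×ˢ Set.Icc 0 S)
      (MeasureTheory.volume.prod MeasureTheory.volume) :=
    hf.continuousOn.integrableOn_compact (isCompact_Icc.prod isCompact_Icc)
  exact this.mono_set (Set.prod_mono Set.Ioc_subset_Icc_self Set.Ioc_subset_Icc_self)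

theorem aux_inner (c T : ℝ) (hc : c ≠ 0) :
    ∫ k in (0:ℝ)..T, Real.sin (k * c) = 1 / c - Real.cos (T * c) * (1 / c) := by
  rw [intervalIntegral.integral_comp_mul_right (fun x => Real.sin x) hc, integral_sin]
  simp; ring

theorem aux_G (a b k S : ℝ) : (∫ s in (0:ℝ)..S, Real.sin (k * (a + b * Real.cosh s))) =
    Real.cos (a * k) * (∫ s in (0:ℝ)..S, Real.sin (b * k * Real.cosh s)) +
    Real.sin (a * k) * (∫ s in (0:ℝ)..S, Real.cos (b * k * Real.cosh s)) := by
  rw [← intervalIntegral.integral_const_mul, ← intervalIntegral.integral_const_mul,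
    ← intervalIntegral.integral_add]
  · refine intervalIntegral.integral_congr fun s _ => ?_
    rw [show k * (a + b * Real.cosh s) = a * k + b * k * Real.cosh s by ring, Real.sin_add]; ring
  · exact Continuous.intervalIntegrable (by fun_prop) _ _
  · exact Continuous.intervalIntegrable (by fun_prop) _ _

theorem aux_cosint (a b T : ℝ) (hab : |a| < b) :
    MeasureTheory.IntegrableOn (fun s => Real.cos (T * (a + b * Real.cosh s)) *
      (1 / (a + b * Real.cosh s))) (Set.Ioi 0) := by
  have : ∀ s, a + b * Real.cosh s ≠ 0 := fun s => (aux_pos a b s hab).ne'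
  refine MeasureTheory.Integrable.mono' (aux_base a b hab).1 (Continuous.aestronglyMeasurable ?_) ?_
  · fun_prop (disch := exact this _)
  · refine Eventually.of_forall fun s => ?_
    have hp := one_div_pos.2 (aux_pos a b s hab)
    rw [norm_mul, Real.norm_of_nonneg hp.le]
    exact mul_le_of_le_one_left hp.le (Real.abs_cos_le_one _)

theorem aux_finite (Y0 : ℝ → ℝ)
    (hY0 : ∀ x : ℝ, 0 < x →
      Tendsto (fun S : ℝ => ∫ s in (0:ℝ)..S, Real.cos (x * Real.cosh s))
        atTop (𝓝 (-(π / 2) * Y0 x)))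
    (a b : ℝ) (hab : |a| < b) (T : ℝ) (hT : 0 ≤ T) :
    (∫ k in (0:ℝ)..T, (Real.cos (a * k) * J0 (b * k) - Real.sin (a * k) * Y0 (b * k))) =
    2 / π * ((π / 2 - Real.arcsin (a / b)) / Real.sqrt (b ^ 2 - a ^ 2) -
      ∫ s in Set.Ioi (0:ℝ), Real.cos (T * (a + b * Real.cosh s)) * (1 / (a + b * Real.cosh s))) := by
  have hb : 0 < b := (abs_nonneg a).trans_lt hab
  have hne : ∀ s, a + b * Real.cosh s ≠ 0 := fun s => (aux_pos a b s hab).ne'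
  obtain ⟨hint, hval⟩ := aux_base a b hab
  have hcos := aux_cosint a b T hab
  have L1 : Tendsto (fun S : ℝ => ∫ k in (0:ℝ)..T, ∫ s in (0:ℝ)..S, Real.sin (k * (a + b * Real.cosh s)))
      atTop (𝓝 (∫ k in (0:ℝ)..T, π / 2 *
        (Real.cos (a * k) * J0 (b * k) - Real.sin (a * k) * Y0 (b * k)))) := by
    refine intervalIntegral.tendsto_integral_filter_of_dominated_convergence
      (fun _ => π + |a| * (T * π + 1 / b)) ?_ ?_ (by simp) ?_
    · refine Eventually.of_forall fun S => Continuous.aestronglyMeasurable ?_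
      exact intervalIntegral.continuous_parametric_intervalIntegral_of_continuous'
        (f := fun k s => Real.sin (k * (a + b * Real.cosh s))) (by fun_prop) 0 S
    · filter_upwards [eventually_ge_atTop 0] with S hS
      refine Eventually.of_forall fun k hk => ?_
      rw [Set.uIoc_of_le hT] at hk
      have hk0 := hk.1
      have hbk : 0 < b * k := by positivity
      rw [aux_G, Real.norm_eq_abs]
      refine (abs_add_le _ _).trans ?_
      rw [abs_mul, abs_mul]
      have i1 := aux_im_le (b * k) S hbk hS
      have i2 := aux_re_le (b * k) S hbk hS
      have i3 : |Real.sin (a * k)| ≤ |a| * k := by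
        refine Real.abs_sin_le_abs.trans ?_
        rw [abs_mul, abs_of_pos hk0]
      refine add_le_add ?_ ?_
      · exact (mul_le_of_le_one_left (abs_nonneg _) (Real.abs_cos_le_one _)).trans i1
      · calc _ ≤ (|a| * k) * (π + 1 / (b * k)) := by gcongr
          _ = |a| * (k * π + 1 / b) := by field_simp
          _ ≤ _ := by gcongr; exact hk.2
    · refine Eventually.of_forall fun k hk => ?_
      rw [Set.uIoc_of_le hT] at hk
      have hbk : 0 < b * k := mul_pos hb hk.1
      simp only [aux_G]
      have := ((aux_im_tendsto (b * k) hbk).const_mul (Real.cos (a * k))).add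
        ((hY0 (b * k) hbk).const_mul (Real.sin (a * k)))
      convert this using 2
      ring
  have L2 : Tendsto (fun S : ℝ => ∫ k in (0:ℝ)..T, ∫ s in (0:ℝ)..S, Real.sin (k * (a + b * Real.cosh s)))
      atTop (𝓝 ((π / 2 - Real.arcsin (a / b)) / Real.sqrt (b ^ 2 - a ^ 2) -
      ∫ s in Set.Ioi (0:ℝ), Real.cos (T * (a + b * Real.cosh s)) * (1 / (a + b * Real.cosh s)))) := by
    rw [← hval, ← MeasureTheory.integral_sub hint hcos]
    refine (MeasureTheory.intervalIntegral_tendsto_integral_Ioi 0 (hint.sub hcos) tendsto_id).congr' ?_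
    filter_upwards [eventually_ge_atTop 0] with S hS
    rw [aux_swap (fun k s => Real.sin (k * (a + b * Real.cosh s))) (by fun_prop) S T hS hT]
    refine intervalIntegral.integral_congr fun s _ => ?_
    simp only [Pi.sub_apply]
    rw [aux_inner _ _ (hne s)]
  have := tendsto_nhds_unique L1 L2
  rw [← this, intervalIntegral.integral_const_mul, ← mul_assoc,
    show 2 / π * (π / 2) = 1 by field_simp, one_mul]

/-- Let `Y₀` be the Bessel function of the second kind of order zero,
characterized for `x > 0` by the Mehler–Sonine representation
`Y₀(x) = −(2/π) lim_{S→∞} ∫₀^S cos(x cosh s) ds`. Then for `|a| < b`, the improper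
integral `∫₀^∞ (cos(ak) J₀(bk) − sin(ak) Y₀(bk)) dk` converges and equals
`(1 − (2/π) arcsin(a/b)) / √(b² − a²)`. -/
theorem stmt_12 (Y0 : ℝ → ℝ)
    (hY0 : ∀ x : ℝ, 0 < x →
      Tendsto (fun S : ℝ => ∫ s in (0:ℝ)..S, Real.cos (x * Real.cosh s))
        atTop (𝓝 (-(π / 2) * Y0 x)))
    (a b : ℝ) (hab : |a| < b) :
    Tendsto (fun T : ℝ =>
        ∫ k in (0:ℝ)..T, (Real.cos (a * k) * J0 (b * k) - Real.sin (a * k) * Y0 (b * k)))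
      atTop (𝓝 ((1 - (2 / π) * Real.arcsin (a / b)) / Real.sqrt (b ^ 2 - a ^ 2))) := by
  have h := ((aux_RL' a b hab).const_sub
    ((π / 2 - Real.arcsin (a / b)) / Real.sqrt (b ^ 2 - a ^ 2))).const_mul (2 / π)
  have e : 2 / π * ((π / 2 - Real.arcsin (a / b)) / Real.sqrt (b ^ 2 - a ^ 2) - 0) =
      (1 - (2 / π) * Real.arcsin (a / b)) / Real.sqrt (b ^ 2 - a ^ 2) := by
    have := Real.pi_ne_zero
    rw [sub_zero, ← mul_div_assoc]
    congr 1
    field_simp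
  rw [e] at h
  refine h.congr' ?_
  filter_upwards [eventually_ge_atTop 0] with T hT
  exact (aux_finite Y0 hY0 a b hab T hT).symm
end
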